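/- Let 1 < q < ∞ and for each n let X̃^{(n)} be uniformly distributed on D̃_{q,1}^n = n^{1/q} B_{q,1}^n. Define G_q : [0,1] → [0, 1/(q-1)] by G_q(x) = (1 - x^{1-1/q})/(q-1), and set δ_n = n^{-(1-1/q)} if 1 < q < 2, δ_n = n^{-1/2} log n if q = 2, and δ_n = n^{-1/q} if 2 < q < ∞. Then for every sequence (a_n) of positive reals with a_n → ∞, P[ max_{1 ≤ i ≤ n} | (X̃_i^{(n)})^* - G_q((i-1)/n) | ≥ a_n δ_n ] → 0 as n → ∞, where (X̃_i^{(n)})^* denotes the i-th largest value among |X̃_1^{(n)}|, …, |X̃_n^{(n)}|. -/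

import Mathlib

open MeasureTheory Finset Filter
open scoped ENNReal NNReal

noncomputable section

/-- `sortedAbs x i` is the `i`-th largest value among `|x 0|, …, |x (n-1)|`
(`i = 0` gives the largest), i.e. the non-increasing rearrangement of `|x|`. -/
def sortedAbs {n : ℕ} (x : Fin n → ℝ) (i : Fin n) : ℝ :=
  |x (Tuple.sort (fun j => |x j|) i.rev)|

/-- The Lorentz norm `‖x‖_{q,1} = ∑_{i=1}^n i^{1/q-1} x_i^*` for `1 < q < ∞`. -/
def lorentzNorm (q : ℝ) {n : ℕ} (x : Fin n → ℝ) : ℝ :=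
  ∑ i : Fin n, ((i : ℝ) + 1) ^ (1 / q - 1) * sortedAbs x i

/-- The unit ball of the Lorentz space `ℓ_{q,1}^n`. -/
def lorentzBall (q : ℝ) (n : ℕ) : Set (Fin n → ℝ) :=
  {x | lorentzNorm q x ≤ 1}

/-- The normalized Lorentz ball `D̃_{q,1}^n = n^{1/q} B_{q,1}^n`. -/
def scaledLorentzBall (q : ℝ) (n : ℕ) : Set (Fin n → ℝ) :=
  (fun x => ((n : ℝ) ^ (1 / q)) • x) '' lorentzBall q n

/-- The uniform probability measure on a set (normalized restricted Lebesgue measure). -/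
def unifOn {n : ℕ} (s : Set (Fin n → ℝ)) : Measure (Fin n → ℝ) :=
  (volume s)⁻¹ • volume.restrict s

/-- The limiting profile `G_q(x) = (1 - x^{1-1/q})/(q-1)`. -/
def Gq (q : ℝ) (x : ℝ) : ℝ := (1 - x ^ (1 - 1 / q)) / (q - 1)

/-- The error rate `δ_n`: `n^{-(1-1/q)}` for `1 < q < 2`, `n^{-1/2} log n` for `q = 2`,
and `n^{-1/q}` for `2 < q < ∞`. -/
def deltan (q : ℝ) (n : ℕ) : ℝ :=
  if q < 2 then (n : ℝ) ^ (1 / q - 1)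
  else if q = 2 then (n : ℝ) ^ (-(1 : ℝ) / 2) * Real.log n
  else (n : ℝ) ^ (-(1 / q))

/-- The standard exponential distribution. -/
def stdExp : Measure ℝ :=
  (volume.restrict (Set.Ioi 0)).withDensity fun t => ENNReal.ofReal (Real.exp (-t))

lemma lintegral_pi_volume_prod (n : ℕ) (f : Fin n → ℝ → ℝ≥0∞) (hf : ∀ i, Measurable (f i)) :
    ∫⁻ x : Fin n → ℝ, ∏ i, f i (x i) = ∏ i, ∫⁻ t, f i t := by
  induction n with
  | zero => simp [lintegral_unique, volume_pi]
  | succ n ih =>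
    have hmp := (volume_preserving_piFinSuccAbove (fun _ : Fin (n + 1) => ℝ) 0).symm
    rw [← hmp.lintegral_comp_emb (MeasurableEquiv.measurableEmbedding _)]
    have h1 : ∀ p : ℝ × (Fin n → ℝ),
        ∏ i, f i ((MeasurableEquiv.piFinSuccAbove (fun _ : Fin (n + 1) => ℝ) 0).symm p i)
          = f 0 p.1 * ∏ i : Fin n, f i.succ (p.2 i) := by
      intro p
      rw [Fin.prod_univ_succ]
      simp [MeasurableEquiv.piFinSuccAbove_symm_apply]
    simp_rw [h1]
    have hm : Measurable fun x : Fin n → ℝ => ∏ i : Fin n, f i.succ (x i) :=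
      Finset.measurable_prod _ fun i _ => (hf _).comp (measurable_pi_apply i)
    rw [Measure.volume_eq_prod, lintegral_prod_mul (hf 0).aemeasurable hm.aemeasurable,
      ih _ fun i => hf i.succ, Fin.prod_univ_succ]

lemma integrableOn_exp_neg_mul_pow (k : ℕ) :
    IntegrableOn (fun t : ℝ => Real.exp (-t) * t ^ k) (Set.Ioi 0) := by
  have h := Real.GammaIntegral_convergent (s := (k : ℝ) + 1) (by positivity)
  simpa using h

lemma integral_exp_neg_mul_pow (k : ℕ) :
    ∫ t in Set.Ioi (0 : ℝ), Real.exp (-t) * t ^ k = (k.factorial : ℝ) := by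
  rw [← Real.Gamma_nat_eq_factorial, Real.Gamma_eq_integral (by positivity)]
  simp

lemma lintegral_exp_neg_mul_pow (k : ℕ) :
    ∫⁻ t in Set.Ioi (0 : ℝ), ENNReal.ofReal (Real.exp (-t) * t ^ k)
      = ENNReal.ofReal (k.factorial : ℝ) := by
  rw [← integral_exp_neg_mul_pow, ofReal_integral_eq_lintegral_ofReal
    (integrableOn_exp_neg_mul_pow k)]
  filter_upwards [ae_restrict_mem measurableSet_Ioi] with t ht
  have : (0 : ℝ) < t := ht
  positivity

lemma lintegral_stdExp {f : ℝ → ℝ≥0∞} (hf : Measurable f) :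
    ∫⁻ t, f t ∂stdExp = ∫⁻ t in Set.Ioi 0, ENNReal.ofReal (Real.exp (-t)) * f t := by
  rw [stdExp, lintegral_withDensity_eq_lintegral_mul _ (by fun_prop) hf]
  rfl

instance : IsProbabilityMeasure stdExp where
  measure_univ := by
    rw [← lintegral_one, lintegral_stdExp measurable_const]
    simpa using lintegral_exp_neg_mul_pow 0

lemma lintegral_stdExp_sq (x c : ℝ) :
    ∫⁻ t, ENNReal.ofReal ((x + c * (t - 1)) ^ 2) ∂stdExp = ENNReal.ofReal (x ^ 2 + c ^ 2) := by
  rw [lintegral_stdExp (by fun_prop)]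
  have e : ∀ t : ℝ, Real.exp (-t) * (x + c * (t - 1)) ^ 2
      = (x - c) ^ 2 * (Real.exp (-t) * t ^ 0) + 2 * (x - c) * c * (Real.exp (-t) * t ^ 1)
        + c ^ 2 * (Real.exp (-t) * t ^ 2) := fun t => by ring
  have i0 := (integrableOn_exp_neg_mul_pow 0).const_mul ((x - c) ^ 2)
  have i1 := (integrableOn_exp_neg_mul_pow 1).const_mul (2 * (x - c) * c)
  have i2 := (integrableOn_exp_neg_mul_pow 2).const_mul (c ^ 2)
  have hi : IntegrableOn (fun t : ℝ => Real.exp (-t) * (x + c * (t - 1)) ^ 2) (Set.Ioi 0) := by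
    simp_rw [e]; exact (i0.add i1).add i2
  simp_rw [← ENNReal.ofReal_mul (Real.exp_pos _).le]
  rw [← ofReal_integral_eq_lintegral_ofReal hi (ae_of_all _ fun t => by positivity)]
  congr 1
  have i01 : IntegrableOn (fun t : ℝ => (x - c) ^ 2 * (Real.exp (-t) * t ^ 0)
      + 2 * (x - c) * c * (Real.exp (-t) * t ^ 1)) (Set.Ioi 0) := i0.add i1
  simp_rw [e]
  rw [integral_add i01 i2, integral_add i0 i1]
  simp_rw [integral_const_mul, integral_exp_neg_mul_pow]
  norm_num
  ring

lemma pi_stdExp (n : ℕ) {I : Set ℝ} (hI : MeasurableSet I)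
    (h : (volume : Measure ℝ).restrict I = volume.restrict (Set.Ioi 0)) :
    Measure.pi (fun _ : Fin n => stdExp)
      = (volume.restrict (Set.univ.pi fun _ : Fin n => I)).withDensity fun t =>
          ENNReal.ofReal (Real.exp (-∑ i, t i)) := by
  have hw : Measurable fun s : ℝ => ENNReal.ofReal (Real.exp (-s)) := by fun_prop
  have hIm : MeasurableSet (Set.univ.pi fun _ : Fin n => I) := MeasurableSet.univ_pi fun _ => hI
  refine Measure.pi_eq fun s hs => ?_
  rw [withDensity_apply _ (MeasurableSet.univ_pi hs),
    Measure.restrict_restrict (MeasurableSet.univ_pi hs), ← Set.pi_inter_distrib,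
    ← lintegral_indicator (MeasurableSet.univ_pi fun i => (hs i).inter hI)]
  have h1 : ∀ t : Fin n → ℝ, (Set.univ.pi fun i => s i ∩ I).indicator
      (fun t => ENNReal.ofReal (Real.exp (-∑ i, t i))) t
      = ∏ i, (s i ∩ I).indicator (fun s => ENNReal.ofReal (Real.exp (-s))) (t i) := by
    intro t
    by_cases ht : t ∈ Set.univ.pi fun i => s i ∩ I
    · rw [Set.indicator_of_mem ht, ← Finset.sum_neg_distrib, Real.exp_sum,
        ENNReal.ofReal_prod_of_nonneg fun i _ => (Real.exp_pos _).le]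
      refine Finset.prod_congr rfl fun i _ => ?_
      rw [Set.indicator_of_mem (show t i ∈ s i ∩ I from ht i (Set.mem_univ i))]
    · rw [Set.indicator_of_notMem ht]
      simp only [Set.mem_pi, Set.mem_univ, true_implies, not_forall] at ht
      obtain ⟨i, hi⟩ := ht
      exact (Finset.prod_eq_zero (Finset.mem_univ i) (Set.indicator_of_notMem hi _)).symm
  simp_rw [h1]
  rw [lintegral_pi_volume_prod n _ fun i => hw.indicator ((hs i).inter hI)]
  refine Finset.prod_congr rfl fun i _ => ?_
  rw [stdExp, withDensity_apply _ (hs i), lintegral_indicator ((hs i).inter hI), ← h,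
    Measure.restrict_restrict (hs i)]

/-- Kolmogorov's maximal inequality for weighted tails of independent centred exponentials. -/
lemma pi_stdExp_maximal (n : ℕ) (c : Fin n → ℝ) (x r : ℝ) (hr : 0 < r) :
    ENNReal.ofReal (r ^ 2) * Measure.pi (fun _ : Fin n => stdExp)
        {t | ∃ k : ℕ, r ≤ |x + ∑ j with k ≤ (j : Fin n).val, c j * (t j - 1)|}
      ≤ ENNReal.ofReal (x ^ 2 + ∑ j, c j ^ 2) := by
  induction n generalizing x with
  | zero =>
    by_cases h : r ≤ |x|
    · calc _ ≤ ENNReal.ofReal (r ^ 2) * 1 := by gcongr; exact prob_le_one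
        _ ≤ _ := by
          rw [mul_one]
          refine ENNReal.ofReal_le_ofReal ?_
          rw [← sq_abs x]
          simpa using pow_le_pow_left₀ hr.le h 2
    · simp [h]
  | succ n ih =>
    by_cases h : r ≤ |x|
    · calc _ ≤ ENNReal.ofReal (r ^ 2) * 1 := by gcongr; exact prob_le_one
        _ ≤ _ := by
          rw [mul_one]
          refine ENNReal.ofReal_le_ofReal ?_
          have := pow_le_pow_left₀ hr.le h 2
          rw [sq_abs] at this
          have := Finset.sum_nonneg fun (j : Fin (n + 1)) (_ : j ∈ Finset.univ) => sq_nonneg (c j)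
          linarith
    · have hmp := measurePreserving_piFinSuccAbove (fun _ : Fin (n + 1) => stdExp) (Fin.last n)
      set A := {t : Fin (n + 1) → ℝ |
        ∃ k : ℕ, r ≤ |x + ∑ j with k ≤ (j : Fin (n + 1)).val, c j * (t j - 1)|} with hA
      set B := {p : ℝ × (Fin n → ℝ) | ∃ k : ℕ, r ≤ |x + c (Fin.last n) * (p.1 - 1)
        + ∑ j with k ≤ (j : Fin n).val, c j.castSucc * (p.2 j - 1)|} with hB
      have hBm : MeasurableSet B := by
        rw [hB, Set.ofPred_exists]
        refine MeasurableSet.iUnion fun k => measurableSet_le measurable_const ?_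
        fun_prop
      have hAB : A ⊆ (MeasurableEquiv.piFinSuccAbove (fun _ : Fin (n + 1) => ℝ)
          (Fin.last n)) ⁻¹' B := by
        rintro t ⟨k, hk⟩
        rw [Finset.sum_filter, Fin.sum_univ_castSucc] at hk
        by_cases hkn : k ≤ n
        · refine ⟨k, ?_⟩
          rw [Finset.sum_filter]
          simp only [Fin.val_castSucc, Fin.val_last, hkn, if_true] at hk
          simp only [MeasurableEquiv.piFinSuccAbove_apply, Fin.insertNthEquiv_symm_apply,
            Fin.removeNth, Fin.succAbove_last]
          convert hk using 2
          ring
        · exfalso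
          apply h
          rw [Finset.sum_eq_zero, if_neg (by simpa using hkn)] at hk
          · simpa using hk
          · intro i _
            rw [if_neg]
            simp; omega
      calc _ ≤ ENNReal.ofReal (r ^ 2) * (stdExp.prod (Measure.pi fun _ : Fin n => stdExp)) B := by
            gcongr
            rw [← hmp.measure_preimage hBm.nullMeasurableSet]
            exact measure_mono hAB
        _ = ∫⁻ s, ENNReal.ofReal (r ^ 2) *
              (Measure.pi fun _ : Fin n => stdExp) (Prod.mk s ⁻¹' B) ∂stdExp := by
            rw [Measure.prod_apply hBm, lintegral_const_mul _ (measurable_measure_prodMk_left hBm)]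
        _ ≤ ∫⁻ s, (ENNReal.ofReal ((x + c (Fin.last n) * (s - 1)) ^ 2)
              + ENNReal.ofReal (∑ j : Fin n, c j.castSucc ^ 2)) ∂stdExp := by
            refine lintegral_mono fun s => ?_
            rw [← ENNReal.ofReal_add (by positivity) (by positivity)]
            exact ih (fun j => c j.castSucc) (x + c (Fin.last n) * (s - 1))
        _ = _ := by
            rw [lintegral_add_right _ measurable_const, lintegral_stdExp_sq, lintegral_const,
              measure_univ, mul_one, ← ENNReal.ofReal_add (by positivity) (by positivity),
              Fin.sum_univ_castSucc]
            congr 1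
            ring

lemma lintegral_gamma_deviation (n : ℕ) :
    ∫⁻ s in Set.Ioi (0 : ℝ), ENNReal.ofReal (Real.exp (-s) * s ^ n * (s - (n + 1)) ^ 2)
      = ENNReal.ofReal (n.factorial * (n + 1)) := by
  have e : ∀ s : ℝ, Real.exp (-s) * s ^ n * (s - (n + 1)) ^ 2
      = Real.exp (-s) * s ^ (n + 2) + (-2 * (n + 1)) * (Real.exp (-s) * s ^ (n + 1))
        + (n + 1) ^ 2 * (Real.exp (-s) * s ^ n) := fun s => by ring
  have i0 := (integrableOn_exp_neg_mul_pow n).const_mul (((n : ℝ) + 1) ^ 2)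
  have i1 := (integrableOn_exp_neg_mul_pow (n + 1)).const_mul (-2 * ((n : ℝ) + 1))
  have i2 := integrableOn_exp_neg_mul_pow (n + 2)
  have i21 : IntegrableOn (fun s : ℝ => Real.exp (-s) * s ^ (n + 2)
      + (-2 * ((n : ℝ) + 1)) * (Real.exp (-s) * s ^ (n + 1))) (Set.Ioi 0) := i2.add i1
  have hi : IntegrableOn (fun s : ℝ => Real.exp (-s) * s ^ n * (s - (n + 1)) ^ 2)
      (Set.Ioi 0) := by
    simp_rw [e]; exact i21.add i0
  rw [← ofReal_integral_eq_lintegral_ofReal hi]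
  · congr 1
    simp_rw [e]
    rw [integral_add i21 i0, integral_add i2 i1]
    simp_rw [integral_const_mul, integral_exp_neg_mul_pow, Nat.factorial_succ]
    push_cast
    ring
  · filter_upwards [ae_restrict_mem measurableSet_Ioi] with s hs
    have : (0 : ℝ) < s := hs
    positivity

/-- Chebyshev's inequality for the Gamma distribution of shape `n + 1`, unnormalized. -/
lemma half_factorial_le_lintegral_gamma (n : ℕ) :
    ENNReal.ofReal (n.factorial / 2) ≤
      ∫⁻ s in Set.Ioi (0 : ℝ) ∩ {s | (s - (n + 1)) ^ 2 < 2 * (n + 1)},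
        ENNReal.ofReal (Real.exp (-s) * s ^ n) := by
  set S : Set ℝ := {s | (s - (n + 1)) ^ 2 < 2 * (n + 1)} with hS
  have hSm : MeasurableSet S := measurableSet_lt (by fun_prop) measurable_const
  have h1 := lintegral_inter_add_sdiff (μ := volume)
    (fun s => ENNReal.ofReal (Real.exp (-s) * s ^ n)) (Set.Ioi (0 : ℝ)) hSm
  rw [lintegral_exp_neg_mul_pow] at h1
  have h2 : ∫⁻ s in Set.Ioi (0 : ℝ) \ S, ENNReal.ofReal (Real.exp (-s) * s ^ n)
      ≤ ENNReal.ofReal (n.factorial / 2) := by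
    calc _ ≤ ∫⁻ s in Set.Ioi (0 : ℝ) \ S, ENNReal.ofReal (1 / (2 * (n + 1))) *
            ENNReal.ofReal (Real.exp (-s) * s ^ n * (s - (n + 1)) ^ 2) := by
          refine setLIntegral_mono' (measurableSet_Ioi.diff hSm) fun s hs => ?_
          have h0 : (0 : ℝ) < s := hs.1
          have h3 : 2 * ((n : ℝ) + 1) ≤ (s - (n + 1)) ^ 2 := not_lt.1 hs.2
          rw [← ENNReal.ofReal_mul (by positivity)]
          refine ENNReal.ofReal_le_ofReal ?_
          have h4 : 0 ≤ Real.exp (-s) * s ^ n := by positivity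
          rw [div_mul_eq_mul_div, one_mul, le_div_iff₀ (by positivity)]
          exact mul_le_mul_of_nonneg_left h3 h4
      _ ≤ ∫⁻ s in Set.Ioi (0 : ℝ), ENNReal.ofReal (1 / (2 * (n + 1))) *
            ENNReal.ofReal (Real.exp (-s) * s ^ n * (s - (n + 1)) ^ 2) :=
          lintegral_mono_set Set.sdiff_subset
      _ = _ := by
          rw [lintegral_const_mul _ (by fun_prop), lintegral_gamma_deviation,
            ← ENNReal.ofReal_mul (by positivity)]
          congr 1
          field_simp
  have h3 : ENNReal.ofReal (n.factorial / 2) + ENNReal.ofReal (n.factorial / 2)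
      = ENNReal.ofReal (n.factorial : ℝ) := by
    rw [← ENNReal.ofReal_add (by positivity) (by positivity)]
    congr 1; ring
  rw [← h3] at h1
  by_contra hlt
  rw [not_le] at hlt
  have h4 := ENNReal.add_lt_add_of_lt_of_le (ne_top_of_le_ne_top ENNReal.ofReal_ne_top h2) hlt h2
  rw [h1] at h4
  exact lt_irrefl _ h4

lemma sortedAbs_comp_perm {n : ℕ} {x y : Fin n → ℝ} {σ : Equiv.Perm (Fin n)}
    (h : ∀ i, |y i| = |x (σ i)|) (i : Fin n) : sortedAbs y i = sortedAbs x i := by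
  have h1 : (fun j => |y j|) = (fun j => |x j|) ∘ σ := funext h
  have h2 := Tuple.comp_perm_comp_sort_eq_comp_sort (f := fun j => |x j|) (σ := σ)
  rw [← h1] at h2
  exact congrFun h2 i.rev

lemma sortedAbs_eq_self {n : ℕ} {x : Fin n → ℝ} (hx : Antitone x) (h0 : ∀ i, 0 ≤ x i)
    (i : Fin n) : sortedAbs x i = x i := by
  have h1 : (fun j => |x j|) = x := funext fun j => abs_of_nonneg (h0 j)
  have h2 := (Tuple.comp_sort_eq_comp_iff_monotone (f := x) (σ := Fin.revPerm)).2
    (fun a b hab => hx (by simpa using Fin.rev_le_rev.2 hab))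
  unfold sortedAbs
  rw [abs_of_nonneg (h0 _), h1]
  have := congrFun h2 i.rev
  simpa using this.symm

lemma sortedAbs_antitone {n : ℕ} (x : Fin n → ℝ) : Antitone (sortedAbs x) := fun _ _ hij =>
  Tuple.monotone_sort (fun j => |x j|) (Fin.rev_le_rev.2 hij)

lemma sortedAbs_nonneg {n : ℕ} (x : Fin n → ℝ) (i : Fin n) : 0 ≤ sortedAbs x i := abs_nonneg _

lemma sortedAbs_smul {n : ℕ} {r : ℝ} (hr : 0 ≤ r) (x : Fin n → ℝ) (i : Fin n) :
    sortedAbs (r • x) i = r * sortedAbs x i := by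
  have h2 := (Tuple.comp_sort_eq_comp_iff_monotone (f := fun j => |(r • x) j|)
    (σ := Tuple.sort fun j => |x j|)).2 (fun a b hab => by
      simpa [abs_mul, abs_of_nonneg hr] using mul_le_mul_of_nonneg_left
        (Tuple.monotone_sort (fun j => |x j|) hab) hr)
  unfold sortedAbs
  have := congrFun h2 i.rev
  simpa [abs_mul, abs_of_nonneg hr] using this.symm

lemma measurable_sortedAbs {n : ℕ} (i : Fin n) :
    Measurable fun x : Fin n → ℝ => sortedAbs x i := by
  let _ : MeasurableSpace (Equiv.Perm (Fin n)) := ⊤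
  have hs : Measurable fun x : Fin n → ℝ => Tuple.sort fun j => |x j| := by
    refine measurable_to_countable' fun σ => ?_
    have : (fun x : Fin n → ℝ => Tuple.sort fun j => |x j|) ⁻¹' {σ}
        = {x | (∀ a b, a ≤ b → |x (σ a)| ≤ |x (σ b)|) ∧
            ∀ a b, a < b → |x (σ a)| = |x (σ b)| → σ a < σ b} := by
      ext x
      simp only [Set.mem_preimage, Set.mem_singleton_iff, Set.mem_ofPred_eq]
      rw [eq_comm, Tuple.eq_sort_iff]
      rfl
    rw [this]
    measurability
  have h2 : Measurable fun p : Equiv.Perm (Fin n) × (Fin n → ℝ) => |p.2 (p.1 i.rev)| :=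
    measurable_from_prod_countable_right fun σ =>
      (continuous_apply (σ i.rev)).abs.measurable
  exact h2.comp (hs.prodMk measurable_id)

lemma measurable_lorentzNorm (q : ℝ) (n : ℕ) :
    Measurable fun x : Fin n → ℝ => lorentzNorm q x :=
  Finset.measurable_sum _ fun i _ => (measurable_sortedAbs i).const_mul _

lemma lorentzNorm_nonneg (q : ℝ) {n : ℕ} (x : Fin n → ℝ) : 0 ≤ lorentzNorm q x :=
  Finset.sum_nonneg fun i _ => mul_nonneg (by positivity) (sortedAbs_nonneg x i)

lemma lorentzNorm_smul (q : ℝ) {n : ℕ} {r : ℝ} (hr : 0 ≤ r) (x : Fin n → ℝ) :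
    lorentzNorm q (r • x) = r * lorentzNorm q x := by
  simp only [lorentzNorm, sortedAbs_smul hr, Finset.mul_sum]
  exact Finset.sum_congr rfl fun i _ => by ring

lemma mem_scaledLorentzBall {q : ℝ} {n : ℕ} (hn : 0 < n) {x : Fin n → ℝ} :
    x ∈ scaledLorentzBall q n ↔ lorentzNorm q x ≤ (n : ℝ) ^ (1 / q) := by
  have hr : 0 < (n : ℝ) ^ (1 / q) := by positivity
  constructor
  · rintro ⟨y, hy, rfl⟩
    rw [lorentzNorm_smul q hr.le]
    exact mul_le_of_le_one_right hr.le hy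
  · intro h
    refine ⟨((n : ℝ) ^ (1 / q))⁻¹ • x, ?_, smul_inv_smul₀ hr.ne' x⟩
    change lorentzNorm q _ ≤ 1
    rw [lorentzNorm_smul q (by positivity), inv_mul_le_iff₀ hr, mul_one]
    exact h

/-- The measure with density `exp (-‖x‖_{q,1})`. -/
def lorentzExp (q : ℝ) (n : ℕ) : Measure (Fin n → ℝ) :=
  volume.withDensity fun x => ENNReal.ofReal (Real.exp (-lorentzNorm q x))

lemma lintegral_exp_neg_Ici (a : ℝ) :
    ∫⁻ s in Set.Ici a, ENNReal.ofReal (Real.exp (-s)) = ENNReal.ofReal (Real.exp (-a)) := by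
  rw [← restrict_Ioi_eq_restrict_Ici, ← integral_exp_neg_Ioi,
    ofReal_integral_eq_lintegral_ofReal (integrableOn_exp_neg_Ioi a)]
  exact ae_of_all _ fun s => (Real.exp_pos _).le

lemma lorentzExp_apply (q : ℝ) {n : ℕ} {A : Set (Fin n → ℝ)} (hA : MeasurableSet A) :
    lorentzExp q n A = ∫⁻ s in Set.Ioi (0 : ℝ), ENNReal.ofReal (Real.exp (-s)) *
      volume (A ∩ {x | lorentzNorm q x ≤ s}) := by
  have hN := measurable_lorentzNorm q n
  have hS : MeasurableSet {p : (Fin n → ℝ) × ℝ | lorentzNorm q p.1 ≤ p.2} :=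
    measurableSet_le (hN.comp measurable_fst) measurable_snd
  have h1 : ∀ x : Fin n → ℝ, ENNReal.ofReal (Real.exp (-lorentzNorm q x))
      = ∫⁻ s in Set.Ici (0 : ℝ), {p : (Fin n → ℝ) × ℝ | lorentzNorm q p.1 ≤ p.2}.indicator
          (fun p => ENNReal.ofReal (Real.exp (-p.2))) (x, s) := by
    intro x
    have h2 : ∀ s, {p : (Fin n → ℝ) × ℝ | lorentzNorm q p.1 ≤ p.2}.indicator
          (fun p => ENNReal.ofReal (Real.exp (-p.2))) (x, s)
        = (Set.Ici (lorentzNorm q x)).indicator (fun s => ENNReal.ofReal (Real.exp (-s))) s :=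
      fun s => rfl
    simp_rw [h2]
    rw [lintegral_indicator measurableSet_Ici, Measure.restrict_restrict measurableSet_Ici,
      Set.inter_eq_left.2 (Set.Ici_subset_Ici.2 (lorentzNorm_nonneg q x)), lintegral_exp_neg_Ici]
  rw [lorentzExp, withDensity_apply _ hA]
  simp_rw [h1]
  rw [lintegral_lintegral_swap, ← restrict_Ioi_eq_restrict_Ici]
  · refine lintegral_congr fun s => ?_
    have h3 : ∀ x : Fin n → ℝ, {p : (Fin n → ℝ) × ℝ | lorentzNorm q p.1 ≤ p.2}.indicator
          (fun p => ENNReal.ofReal (Real.exp (-p.2))) (x, s)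
        = {x | lorentzNorm q x ≤ s}.indicator (fun _ => ENNReal.ofReal (Real.exp (-s))) x :=
      fun x => rfl
    simp_rw [h3]
    have hm : MeasurableSet {x : Fin n → ℝ | lorentzNorm q x ≤ s} :=
      measurableSet_le hN measurable_const
    rw [lintegral_indicator hm, Measure.restrict_restrict hm, setLIntegral_const, Set.inter_comm]
  · exact (Measurable.indicator (by fun_prop) hS).aemeasurable

lemma lorentzExp_univ (q : ℝ) {n : ℕ} {r : ℝ} (hr : 0 < r) :
    ENNReal.ofReal (r ^ n) * lorentzExp q n Set.univ
      = ENNReal.ofReal n.factorial * volume {x : Fin n → ℝ | lorentzNorm q x ≤ r} := by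
  rw [lorentzExp_apply q MeasurableSet.univ, ← lintegral_const_mul']
  · rw [← lintegral_exp_neg_mul_pow, ← lintegral_mul_const _ (by fun_prop)]
    refine setLIntegral_congr_fun measurableSet_Ioi fun s hs => ?_
    have hs : (0 : ℝ) < s := hs
    have h1 : {x : Fin n → ℝ | lorentzNorm q x ≤ s}
        = (fun x => (r / s) • x) ⁻¹' {x : Fin n → ℝ | lorentzNorm q x ≤ r} := by
      ext x
      simp only [Set.mem_preimage, Set.mem_ofPred_eq]
      rw [lorentzNorm_smul q (by positivity), div_mul_eq_mul_div, div_le_iff₀ hs,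
        mul_le_mul_iff_right₀ hr]
    simp only [Set.univ_inter]
    rw [h1, Measure.addHaar_preimage_smul _ (by positivity)]
    simp only [Module.finrank_fin_fun]
    rw [abs_of_pos (by positivity), ← mul_assoc, ← mul_assoc,
      ← ENNReal.ofReal_mul (by positivity), ← ENNReal.ofReal_mul (by positivity)]
    congr 2
    rw [div_pow]
    field_simp
  · exact ENNReal.ofReal_ne_top

lemma volume_inter_lorentz_le (q : ℝ) {n : ℕ} {r : ℝ} (hr : 0 < r) {A A' : Set (Fin n → ℝ)}
    (hA' : MeasurableSet A')
    (h : ∀ s : ℝ, 0 < s → (s - (n + 1)) ^ 2 < 2 * (n + 1) → ∀ x ∈ A, (s / r) • x ∈ A') :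
    ENNReal.ofReal (n.factorial / 2) * volume (A ∩ {x | lorentzNorm q x ≤ r})
      ≤ ENNReal.ofReal (r ^ n) * lorentzExp q n A' := by
  rw [lorentzExp_apply q hA', ← lintegral_const_mul']
  · calc _ ≤ (∫⁻ s in Set.Ioi (0 : ℝ) ∩ {s | (s - (n + 1)) ^ 2 < 2 * (n + 1)},
          ENNReal.ofReal (Real.exp (-s) * s ^ n)) * volume (A ∩ {x | lorentzNorm q x ≤ r}) := by
          gcongr
          exact half_factorial_le_lintegral_gamma n
      _ = ∫⁻ s in Set.Ioi (0 : ℝ) ∩ {s | (s - (n + 1)) ^ 2 < 2 * (n + 1)},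
          ENNReal.ofReal (Real.exp (-s) * s ^ n) * volume (A ∩ {x | lorentzNorm q x ≤ r}) :=
          (lintegral_mul_const _ (by fun_prop)).symm
      _ ≤ ∫⁻ s in Set.Ioi (0 : ℝ) ∩ {s | (s - (n + 1)) ^ 2 < 2 * (n + 1)},
          ENNReal.ofReal (r ^ n) * (ENNReal.ofReal (Real.exp (-s)) *
            volume (A' ∩ {x | lorentzNorm q x ≤ s})) := by
          refine setLIntegral_mono' (measurableSet_Ioi.inter
            (measurableSet_lt (by fun_prop) measurable_const)) fun s hs => ?_
          have hs0 : (0 : ℝ) < s := hs.1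
          have h1 : A ∩ {x | lorentzNorm q x ≤ r}
              ⊆ (fun x => (s / r) • x) ⁻¹' (A' ∩ {x | lorentzNorm q x ≤ s}) := by
            rintro x ⟨hxA, hx⟩
            refine ⟨h s hs0 hs.2 x hxA, ?_⟩
            change lorentzNorm q _ ≤ s
            rw [lorentzNorm_smul q (by positivity), div_mul_eq_mul_div, div_le_iff₀ hr]
            exact mul_le_mul_of_nonneg_left hx hs0.le
          refine (mul_le_mul_right (measure_mono h1) _).trans_eq ?_
          rw [Measure.addHaar_preimage_smul _ (by positivity)]
          simp only [Module.finrank_fin_fun]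
          rw [abs_of_pos (by positivity), ← mul_assoc, ← mul_assoc,
            ← ENNReal.ofReal_mul (by positivity), ← ENNReal.ofReal_mul (by positivity)]
          congr 2
          rw [div_pow]
          field_simp
      _ ≤ _ := lintegral_mono_set Set.inter_subset_left
  · exact ENNReal.ofReal_ne_top

/-- The action of a signed permutation on coordinates. -/
def signedPerm {n : ℕ} (g : Equiv.Perm (Fin n) × (Fin n → Bool)) (x : Fin n → ℝ) : Fin n → ℝ :=
  fun i => if g.2 i then x (g.1 i) else -x (g.1 i)

lemma abs_signedPerm {n : ℕ} (g : Equiv.Perm (Fin n) × (Fin n → Bool)) (x : Fin n → ℝ)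
    (i : Fin n) : |signedPerm g x i| = |x (g.1 i)| := by
  unfold signedPerm
  split_ifs <;> simp

lemma measurePreserving_signedPerm {n : ℕ} (g : Equiv.Perm (Fin n) × (Fin n → Bool)) :
    MeasurePreserving (signedPerm g) := by
  have h1 := volume_measurePreserving_piCongrLeft (fun _ : Fin n => ℝ) g.1.symm
  have h2 : MeasurePreserving (fun (x : Fin n → ℝ) i => if g.2 i then x i else -x i) := by
    refine volume_preserving_pi (f := fun i y => if g.2 i then y else -y) fun i => ?_
    cases hi : g.2 i
    · simpa using Measure.measurePreserving_neg (volume : Measure ℝ)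
    · simp only [if_true]
      exact MeasurePreserving.id (volume : Measure ℝ)
  have h3 : signedPerm g = (fun (x : Fin n → ℝ) i => if g.2 i then x i else -x i) ∘
      MeasurableEquiv.piCongrLeft (fun _ : Fin n => ℝ) g.1.symm := by
    funext x i
    have h4 : (MeasurableEquiv.piCongrLeft (fun _ : Fin n => ℝ) g.1.symm) x i = x (g.1 i) := by
      have := MeasurableEquiv.piCongrLeft_apply_apply (β := fun _ : Fin n => ℝ) g.1.symm x (g.1 i)
      simpa using this
    simp only [signedPerm, Function.comp, h4]
  rw [h3]
  exact h2.comp h1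

/-- The closed Weyl chamber of non-increasing nonnegative vectors. -/
def closedChamber (n : ℕ) : Set (Fin n → ℝ) := {x | Antitone x ∧ ∀ i, 0 ≤ x i}

/-- The open Weyl chamber of decreasing positive vectors. -/
def openChamber (n : ℕ) : Set (Fin n → ℝ) := {x | StrictAnti x ∧ ∀ i, 0 < x i}

lemma measurableSet_closedChamber (n : ℕ) : MeasurableSet (closedChamber n) := by
  unfold closedChamber Antitone
  measurability

lemma measurableSet_openChamber (n : ℕ) : MeasurableSet (openChamber n) := by
  unfold openChamber StrictAnti
  measurability

lemma exists_signedPerm_mem_closedChamber {n : ℕ} (x : Fin n → ℝ) :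
    ∃ g, signedPerm g x ∈ closedChamber n := by
  let σ : Equiv.Perm (Fin n) := Fin.revPerm.trans (Tuple.sort fun j => |x j|)
  have h : signedPerm (σ, fun i => decide (0 ≤ x (σ i))) x = fun i => |x (σ i)| := by
    ext i
    by_cases hi : 0 ≤ x (σ i)
    · simp [signedPerm, hi, abs_of_nonneg hi]
    · simp [signedPerm, hi, abs_of_neg (not_le.1 hi)]
  refine ⟨(σ, fun i => decide (0 ≤ x (σ i))), ?_⟩
  rw [h]
  exact ⟨fun i j hij => sortedAbs_antitone x hij, fun i => abs_nonneg _⟩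

lemma signedPerm_mem_openChamber_unique {n : ℕ} {x : Fin n → ℝ}
    {g g' : Equiv.Perm (Fin n) × (Fin n → Bool)} (h : signedPerm g x ∈ openChamber n)
    (h' : signedPerm g' x ∈ openChamber n) : g = g' := by
  have key : ∀ g : Equiv.Perm (Fin n) × (Fin n → Bool), signedPerm g x ∈ openChamber n →
      StrictAnti ((fun i => |x i|) ∘ g.1) := by
    intro g hg
    have : (fun i => |x i|) ∘ g.1 = signedPerm g x := by
      ext i
      rw [← abs_of_pos (hg.2 i), abs_signedPerm]; rfl
    rw [this]; exact hg.1
  have hσ := Tuple.unique_antitone (key g h).antitone (key g' h').antitone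
  have hinj : Function.Injective fun i => |x i| := by
    have := (key g h).injective.comp g.1.symm.injective
    simpa [Function.comp_def] using this
  have hperm : g.1 = g'.1 := Equiv.ext fun i => hinj (congrFun hσ i)
  refine Prod.ext hperm (funext fun i => ?_)
  have h1 := h.2 i
  have h2 := h'.2 i
  unfold signedPerm at h1 h2
  rw [← hperm] at h2
  cases e1 : g.2 i <;> cases e2 : g'.2 i <;> simp only [e1, e2, Bool.false_eq_true, if_true,
    if_false] at h1 h2 <;> first | rfl | linarith

lemma lintegral_le_card_mul_closedChamber {n : ℕ} {F : (Fin n → ℝ) → ℝ≥0∞} (hF : Measurable F)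
    (hinv : ∀ g x, F (signedPerm g x) = F x) :
    ∫⁻ x, F x ≤ Fintype.card (Equiv.Perm (Fin n) × (Fin n → Bool)) *
      ∫⁻ x in closedChamber n, F x := by
  calc ∫⁻ x, F x = ∫⁻ x in ⋃ g, signedPerm g ⁻¹' closedChamber n, F x := by
        have h : ⋃ g, signedPerm g ⁻¹' closedChamber n = Set.univ :=
          Set.iUnion_eq_univ_iff.2 exists_signedPerm_mem_closedChamber
        rw [h, Measure.restrict_univ]
    _ ≤ ∑' g, ∫⁻ x in signedPerm g ⁻¹' closedChamber n, F x := lintegral_iUnion_le _ _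
    _ = ∑' g : Equiv.Perm (Fin n) × (Fin n → Bool), ∫⁻ x in closedChamber n, F x := by
        refine tsum_congr fun g => ?_
        rw [← (measurePreserving_signedPerm g).setLIntegral_comp_preimage
          (measurableSet_closedChamber n) hF]
        simp_rw [hinv]
    _ = _ := by simp [tsum_fintype]

lemma card_mul_openChamber_le_lintegral {n : ℕ} {F : (Fin n → ℝ) → ℝ≥0∞} (hF : Measurable F)
    (hinv : ∀ g x, F (signedPerm g x) = F x) :
    Fintype.card (Equiv.Perm (Fin n) × (Fin n → Bool)) * ∫⁻ x in openChamber n, F x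
      ≤ ∫⁻ x, F x := by
  calc _ = ∑' g : Equiv.Perm (Fin n) × (Fin n → Bool), ∫⁻ x in openChamber n, F x := by
        simp [tsum_fintype]
    _ = ∑' g, ∫⁻ x in signedPerm g ⁻¹' openChamber n, F x := by
        refine tsum_congr fun g => ?_
        rw [← (measurePreserving_signedPerm g).setLIntegral_comp_preimage
          (measurableSet_openChamber n) hF]
        simp_rw [hinv]
    _ = ∫⁻ x in ⋃ g, signedPerm g ⁻¹' openChamber n, F x := by
        refine (lintegral_iUnion (fun g => (measurePreserving_signedPerm g).measurable
          (measurableSet_openChamber n)) (fun g g' hne => ?_) _).symm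
        refine Set.disjoint_left.2 fun x hx hx' => hne ?_
        exact signedPerm_mem_openChamber_unique hx hx'
    _ ≤ _ := setLIntegral_le_lintegral _ _

/-- The Lorentz norm of the indicator of the first `k` coordinates. -/
def lorentzWeight (q : ℝ) (k : ℕ) : ℝ := ∑ i ∈ Finset.range k, ((i : ℝ) + 1) ^ (1 / q - 1)

lemma lorentzWeight_pos (q : ℝ) {k : ℕ} (hk : 0 < k) : 0 < lorentzWeight q k :=
  Finset.sum_pos (fun i _ => by positivity) (by simpa using hk.ne')

/-- The matrix of the map sending normalized spacings to the corresponding sorted vector. -/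
def spacingMatrix (q : ℝ) (n : ℕ) : Matrix (Fin n) (Fin n) ℝ :=
  Matrix.of fun i j => if i ≤ j then (lorentzWeight q (j + 1))⁻¹ else 0

/-- The vector with normalized spacings `t`. -/
def ofSpacings (q : ℝ) (n : ℕ) : (Fin n → ℝ) →ₗ[ℝ] (Fin n → ℝ) :=
  Matrix.toLin' (spacingMatrix q n)

lemma ofSpacings_apply (q : ℝ) {n : ℕ} (t : Fin n → ℝ) (i : Fin n) :
    ofSpacings q n t i = ∑ j with i ≤ j, (lorentzWeight q (j + 1))⁻¹ * t j := by
  simp [ofSpacings, spacingMatrix, Matrix.mulVec, dotProduct, Finset.sum_filter]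

lemma det_ofSpacings_ne_zero (q : ℝ) (n : ℕ) : LinearMap.det (ofSpacings q n) ≠ 0 := by
  rw [ofSpacings, LinearMap.det_toLin', Matrix.det_of_isUpperTriangular]
  · refine Finset.prod_ne_zero_iff.2 fun i _ => ?_
    simpa [spacingMatrix] using (lorentzWeight_pos q (Nat.succ_pos _)).ne'
  · intro i j hij
    have hij : j < i := hij
    simp [spacingMatrix, not_le.2 hij]

lemma ofSpacings_eq_add {q : ℝ} {n : ℕ} (t : Fin n → ℝ) (i : Fin n) :
    ofSpacings q n t i = (lorentzWeight q (i + 1))⁻¹ * t i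
      + ∑ j with i < j, (lorentzWeight q (j + 1))⁻¹ * t j := by
  rw [ofSpacings_apply, Finset.sum_filter, Finset.sum_filter,
    ← Finset.add_sum_erase _ _ (Finset.mem_univ i),
    ← Finset.add_sum_erase (Finset.univ : Finset (Fin n))
      (fun j => if i < j then (lorentzWeight q (j + 1))⁻¹ * t j else 0) (Finset.mem_univ i)]
  simp only [le_refl, if_true, lt_irrefl, if_false, zero_add]
  congr 1
  refine Finset.sum_congr rfl fun j hj => ?_
  simp only [le_iff_lt_or_eq, (Finset.ne_of_mem_erase hj).symm, or_false]

lemma nonneg_of_ofSpacings_mem_closedChamber {q : ℝ} {n : ℕ} {t : Fin n → ℝ}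
    (ht : ofSpacings q n t ∈ closedChamber n) (i : Fin n) : 0 ≤ t i := by
  have hK := lorentzWeight_pos q (Nat.succ_pos (i : ℕ))
  have h1 : ∑ j with i < j, (lorentzWeight q (j + 1))⁻¹ * t j ≤ ofSpacings q n t i := by
    by_cases hi : (i : ℕ) + 1 < n
    · have h2 : ofSpacings q n t ⟨i + 1, hi⟩
          = ∑ j with i < j, (lorentzWeight q (j + 1))⁻¹ * t j := by
        rw [ofSpacings_apply]
        rfl
      rw [← h2]
      exact ht.1 (Fin.le_def.2 (Nat.le_succ _))
    · rw [Finset.sum_eq_zero]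
      · exact ht.2 i
      · intro j hj
        have := (Finset.mem_filter.1 hj).2
        omega
  rw [ofSpacings_eq_add] at h1
  have h3 : 0 ≤ (lorentzWeight q (i + 1))⁻¹ * t i := by linarith
  exact nonneg_of_mul_nonneg_right h3 (inv_pos.2 hK)

lemma ofSpacings_mem_openChamber {q : ℝ} {n : ℕ} {t : Fin n → ℝ} (ht : ∀ i, 0 < t i) :
    ofSpacings q n t ∈ openChamber n := by
  have hpos : ∀ j : Fin n, 0 < (lorentzWeight q (j + 1))⁻¹ * t j := fun j =>
    mul_pos (inv_pos.2 (lorentzWeight_pos q (Nat.succ_pos _))) (ht j)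
  refine ⟨fun i j hij => ?_, fun i => ?_⟩
  · rw [ofSpacings_eq_add t i, ofSpacings_apply]
    refine lt_add_of_pos_of_le (hpos i) ?_
    refine Finset.sum_le_sum_of_subset_of_nonneg ?_ fun k _ _ => (hpos k).le
    intro k hk
    simp only [Finset.mem_filter, Finset.mem_univ, true_and] at hk ⊢
    exact hij.trans_le hk
  · rw [ofSpacings_apply]
    exact Finset.sum_pos (fun k _ => hpos k) ⟨i, by simp⟩

lemma ofSpacings_mem_closedChamber {q : ℝ} {n : ℕ} {t : Fin n → ℝ} (ht : ∀ i, 0 ≤ t i) :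
    ofSpacings q n t ∈ closedChamber n := by
  have hpos : ∀ j : Fin n, 0 ≤ (lorentzWeight q (j + 1))⁻¹ * t j := fun j =>
    mul_nonneg (inv_pos.2 (lorentzWeight_pos q (Nat.succ_pos _))).le (ht j)
  refine ⟨fun i j hij => ?_, fun i => ?_⟩
  · rw [ofSpacings_apply, ofSpacings_apply]
    refine Finset.sum_le_sum_of_subset_of_nonneg ?_ fun k _ _ => hpos k
    intro k hk
    simp only [Finset.mem_filter, Finset.mem_univ, true_and] at hk ⊢
    exact hij.trans hk
  · rw [ofSpacings_apply]
    exact Finset.sum_nonneg fun k _ => hpos k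

lemma lorentzNorm_ofSpacings {q : ℝ} {n : ℕ} {t : Fin n → ℝ} (ht : ∀ i, 0 ≤ t i) :
    lorentzNorm q (ofSpacings q n t) = ∑ i, t i := by
  have hC := ofSpacings_mem_closedChamber (q := q) ht
  simp only [lorentzNorm, sortedAbs_eq_self hC.1 hC.2, ofSpacings_apply, Finset.sum_filter,
    Finset.mul_sum]
  rw [Finset.sum_comm]
  refine Finset.sum_congr rfl fun j _ => ?_
  have h1 : ∑ i : Fin n, (if i ≤ j then ((i : ℝ) + 1) ^ (1 / q - 1) else 0)
      = lorentzWeight q (j + 1) := by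
    have h2 := Fin.sum_univ_eq_sum_range
      (fun i : ℕ => if i ≤ (j : ℕ) then ((i : ℝ) + 1) ^ (1 / q - 1) else 0) n
    simp only [Fin.le_def]
    rw [h2, ← Finset.sum_filter, lorentzWeight]
    congr 1
    ext i
    simp only [Finset.mem_filter, Finset.mem_range]
    omega
  calc _ = (∑ i : Fin n, (if i ≤ j then ((i : ℝ) + 1) ^ (1 / q - 1) else 0)) *
        ((lorentzWeight q (j + 1))⁻¹ * t j) := by
        rw [Finset.sum_mul]
        refine Finset.sum_congr rfl fun i _ => ?_
        split_ifs <;> simp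
    _ = t j := by
        rw [h1, mul_inv_cancel_left₀ (lorentzWeight_pos q (Nat.succ_pos _)).ne']

/-- For `x` with density proportional to `exp (-‖x‖_{q,1})`, the normalized spacings of the
non-increasing rearrangement are independent standard exponentials. -/
lemma lorentzExp_le (q : ℝ) {n : ℕ} {A : Set (Fin n → ℝ)} (hA : MeasurableSet A)
    (hinv : ∀ g x, signedPerm g x ∈ A ↔ x ∈ A) :
    lorentzExp q n A ≤ lorentzExp q n Set.univ *
      Measure.pi (fun _ : Fin n => stdExp) (ofSpacings q n ⁻¹' A) := by
  have hN : ∀ g (x : Fin n → ℝ), lorentzNorm q (signedPerm g x) = lorentzNorm q x := fun g x =>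
    Finset.sum_congr rfl fun i _ => by rw [sortedAbs_comp_perm (abs_signedPerm g x)]
  have hTm : Measurable (ofSpacings q n) := (LinearMap.continuous_of_finiteDimensional _).measurable
  set E : (Fin n → ℝ) → ℝ≥0∞ := fun x => ENNReal.ofReal (Real.exp (-lorentzNorm q x)) with hE
  have hEm : Measurable E := by
    have := measurable_lorentzNorm q n
    fun_prop
  set T := ofSpacings q n with hT
  set m : ℝ≥0∞ := (Fintype.card (Equiv.Perm (Fin n) × (Fin n → Bool)) : ℝ≥0∞)
  set c : ℝ≥0∞ := ENNReal.ofReal |(LinearMap.det T)⁻¹| with hc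
  have hc0 : c ≠ 0 := by
    rw [hc, Ne, ENNReal.ofReal_eq_zero, not_le, abs_pos]
    exact inv_ne_zero (det_ofSpacings_ne_zero q n)
  have hct : c ≠ ⊤ := ENNReal.ofReal_ne_top
  have hcv : ∀ F : (Fin n → ℝ) → ℝ≥0∞, Measurable F → ∀ S : Set (Fin n → ℝ), MeasurableSet S →
      c * ∫⁻ x in S, F x = ∫⁻ t in T ⁻¹' S, F (T t) := by
    intro F hF S hS
    have h := Measure.map_linearMap_addHaar_eq_smul_addHaar (volume : Measure (Fin n → ℝ))
      (det_ofSpacings_ne_zero q n)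
    rw [← setLIntegral_map hS hF hTm, h, Measure.restrict_smul, lintegral_smul_measure]
    rfl
  have hupper : c * lorentzExp q n A ≤ m *
      Measure.pi (fun _ : Fin n => stdExp) (T ⁻¹' A) := by
    have h1 : lorentzExp q n A ≤ m * ∫⁻ x in closedChamber n, A.indicator E x := by
      rw [lorentzExp, withDensity_apply _ hA, ← lintegral_indicator hA]
      refine lintegral_le_card_mul_closedChamber (hEm.indicator hA) fun g x => ?_
      by_cases hx : x ∈ A
      · rw [Set.indicator_of_mem hx, Set.indicator_of_mem ((hinv g x).2 hx)]
        simp only [hN]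
      · rw [Set.indicator_of_notMem hx, Set.indicator_of_notMem fun h => hx ((hinv g x).1 h)]
    calc c * lorentzExp q n A ≤ c * (m * ∫⁻ x in closedChamber n, A.indicator E x) := by gcongr
      _ = m * ∫⁻ t in T ⁻¹' closedChamber n, A.indicator E (T t) := by
          rw [← hcv _ (hEm.indicator hA) _ (measurableSet_closedChamber n)]
          ring
      _ ≤ m * ∫⁻ t in Set.univ.pi fun _ : Fin n => Set.Ici (0 : ℝ), A.indicator E (T t) := by
          gcongr
          intro t ht i _
          exact nonneg_of_ofSpacings_mem_closedChamber ht i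
      _ = _ := by
          rw [pi_stdExp n measurableSet_Ici restrict_Ioi_eq_restrict_Ici.symm,
            withDensity_apply _ (hTm hA), ← lintegral_indicator (hTm hA)]
          congr 1
          refine setLIntegral_congr_fun (MeasurableSet.univ_pi fun _ => measurableSet_Ici)
            fun t ht => ?_
          have ht0 : ∀ i, 0 ≤ t i := fun i => ht i (Set.mem_univ i)
          by_cases hx : T t ∈ A
          · rw [Set.indicator_of_mem hx, Set.indicator_of_mem (show t ∈ T ⁻¹' A from hx), hE]
            simp only [hT, lorentzNorm_ofSpacings ht0]
          · rw [Set.indicator_of_notMem hx, Set.indicator_of_notMem (show t ∉ T ⁻¹' A from hx)]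
  have hlower : m ≤ c * lorentzExp q n Set.univ := by
    calc m = m * Measure.pi (fun _ : Fin n => stdExp) Set.univ := by rw [measure_univ, mul_one]
      _ = m * ∫⁻ t in Set.univ.pi fun _ : Fin n => Set.Ioi (0 : ℝ), E (T t) := by
          rw [pi_stdExp n measurableSet_Ioi rfl, withDensity_apply _ MeasurableSet.univ,
            Measure.restrict_univ]
          congr 1
          refine setLIntegral_congr_fun (MeasurableSet.univ_pi fun _ => measurableSet_Ioi)
            fun t ht => ?_
          have ht0 : ∀ i, 0 ≤ t i := fun i => le_of_lt (ht i (Set.mem_univ i))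
          simp only [hE, hT, lorentzNorm_ofSpacings ht0]
      _ ≤ m * ∫⁻ t in T ⁻¹' openChamber n, E (T t) := by
          gcongr
          intro t ht
          exact ofSpacings_mem_openChamber fun i => ht i (Set.mem_univ i)
      _ = c * (m * ∫⁻ x in openChamber n, E x) := by
          rw [← hcv _ hEm _ (measurableSet_openChamber n)]
          ring
      _ ≤ _ := by
          gcongr
          rw [lorentzExp, withDensity_apply _ MeasurableSet.univ, Measure.restrict_univ]
          exact card_mul_openChamber_le_lintegral hEm fun g x => by simp only [hE, hN]
  refine (ENNReal.mul_le_mul_iff_right hc0 hct).1 ?_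
  calc _ ≤ _ := hupper
    _ ≤ c * lorentzExp q n Set.univ * Measure.pi (fun _ : Fin n => stdExp) (T ⁻¹' A) := by gcongr
    _ = _ := mul_assoc _ _ _

lemma rpow_add_one_sub_rpow_le {p : ℝ} (h0 : 0 ≤ p) (h1 : p ≤ 1) {a : ℝ} (ha : 0 < a) :
    (a + 1) ^ p - a ^ p ≤ p * a ^ (p - 1) := by
  have h := rpow_one_add_le_one_add_mul_self (s := 1 / a)
    (by have : 0 < 1 / a := by positivity
        linarith) h0 h1
  have e : a + 1 = a * (1 + 1 / a) := by field_simp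
  rw [e, Real.mul_rpow ha.le (by positivity), Real.rpow_sub_one ha.ne']
  have := mul_le_mul_of_nonneg_left h (Real.rpow_nonneg ha.le p)
  have e2 : a ^ p * (1 + p * (1 / a)) = a ^ p + p * (a ^ p / a) := by ring
  linarith

lemma le_rpow_add_one_sub_rpow {p : ℝ} (h0 : 0 ≤ p) (h1 : p ≤ 1) {a : ℝ} (ha : 0 ≤ a) :
    p * (a + 1) ^ (p - 1) ≤ (a + 1) ^ p - a ^ p := by
  have hb : 0 < a + 1 := by linarith
  have hle : 1 / (a + 1) ≤ 1 := by rw [div_le_one hb]; linarith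
  have h := rpow_one_add_le_one_add_mul_self (s := -(1 / (a + 1))) (by linarith) h0 h1
  have e : a = (a + 1) * (1 + -(1 / (a + 1))) := by field_simp; ring
  have e1 : a ^ p = (a + 1) ^ p * (1 + -(1 / (a + 1))) ^ p := by
    rw [← Real.mul_rpow hb.le (by linarith), ← e]
  rw [e1, Real.rpow_sub_one hb.ne']
  have := mul_le_mul_of_nonneg_left h (Real.rpow_nonneg hb.le p)
  have e2 : (a + 1) ^ p * (1 + p * -(1 / (a + 1))) = (a + 1) ^ p - p * ((a + 1) ^ p / (a + 1)) := by
    ring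
  linarith

lemma lorentzWeight_upper {q : ℝ} (hq : 1 < q) (k : ℕ) :
    1 / q * lorentzWeight q k ≤ (k : ℝ) ^ (1 / q) := by
  have h0 : 0 < 1 / q := by positivity
  have h1 : 1 / q ≤ 1 := by rw [div_le_one (by linarith)]; exact hq.le
  induction k with
  | zero =>
    simp only [lorentzWeight, Finset.range_zero, Finset.sum_empty, mul_zero]
    positivity
  | succ k ih =>
    have := le_rpow_add_one_sub_rpow h0.le h1 (Nat.cast_nonneg k)
    rw [lorentzWeight, Finset.sum_range_succ, ← lorentzWeight, mul_add]
    push_cast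
    linarith

lemma lorentzWeight_lower {q : ℝ} (hq : 1 < q) (k : ℕ) :
    (k : ℝ) ^ (1 / q) - 1 ≤ 1 / q * lorentzWeight q k := by
  have h0 : 0 < 1 / q := by positivity
  have h1 : 1 / q ≤ 1 := by rw [div_le_one (by linarith)]; exact hq.le
  suffices h : ((k : ℝ) + 1) ^ (1 / q) - 1 ≤ 1 / q * lorentzWeight q k by
    have := Real.rpow_le_rpow (Nat.cast_nonneg k) (by linarith : (k : ℝ) ≤ k + 1) h0.le
    linarith
  induction k with
  | zero => simp [lorentzWeight]
  | succ k ih =>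
    have := rpow_add_one_sub_rpow_le h0.le h1 (a := (k : ℝ) + 1) (by positivity)
    rw [lorentzWeight, Finset.sum_range_succ, ← lorentzWeight, mul_add]
    push_cast
    linarith

lemma rpow_le_lorentzWeight {q : ℝ} (hq : 1 < q) {k : ℕ} (hk : 0 < k) :
    (k : ℝ) ^ (1 / q) ≤ lorentzWeight q k := by
  have h1 : 1 / q ≤ 1 := by rw [div_le_one (by linarith)]; exact hq.le
  have hk' : (0 : ℝ) < k := by exact_mod_cast hk
  have h2 : ∀ i ∈ Finset.range k, (k : ℝ) ^ (1 / q - 1) ≤ ((i : ℝ) + 1) ^ (1 / q - 1) := by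
    intro i hi
    have : (i : ℝ) + 1 ≤ k := by exact_mod_cast Finset.mem_range.1 hi
    exact Real.rpow_le_rpow_of_nonpos (by positivity) this (by linarith)
  have := Finset.card_nsmul_le_sum _ _ _ h2
  rw [Finset.card_range, nsmul_eq_mul, Real.rpow_sub_one hk'.ne', mul_div_cancel₀ _ hk'.ne'] at this
  exact this

lemma abs_inv_lorentzWeight_sub_le {q : ℝ} (hq : 1 < q) (j : ℕ) :
    |(lorentzWeight q (j + 1))⁻¹
        - 1 / (q - 1) * (((j : ℝ) + 1) ^ (1 - 1 / q) - (j : ℝ) ^ (1 - 1 / q))|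
      ≤ (1 / (q - 1) + 3) * ((j : ℝ) + 1) ^ (-(2 / q)) := by
  have h0 : 0 < 1 / q := by positivity
  have h1 : 1 / q < 1 := by rw [div_lt_one (by linarith)]; exact hq
  have hq1 : 0 < q - 1 := by linarith
  have hβ : 1 / (q - 1) * (1 - 1 / q) = 1 / q := by field_simp
  have hβ0 : 0 < 1 / (q - 1) := by positivity
  set α := 1 / q with hα
  set β := 1 / (q - 1)
  set K := lorentzWeight q (j + 1) with hK
  have hKpos : 0 < K := lorentzWeight_pos q (Nat.succ_pos j)
  have hu := lorentzWeight_upper hq (j + 1)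
  have hl := lorentzWeight_lower hq (j + 1)
  have hr := rpow_le_lorentzWeight hq (Nat.succ_pos j)
  push_cast at hu hl hr
  rw [← hK, ← hα] at hu hl hr
  have hj : (0 : ℝ) < j + 1 := by positivity
  set y := ((j : ℝ) + 1) ^ α with hy
  have hypos : 0 < y := Real.rpow_pos_of_pos hj _
  have hy1 : 1 ≤ y := Real.one_le_rpow (by linarith [(Nat.cast_nonneg j : (0 : ℝ) ≤ j)]) h0.le
  have e1 : ((j : ℝ) + 1) ^ (-(2 / q)) = (y ^ 2)⁻¹ := by
    rw [Real.rpow_neg hj.le, hy, ← Real.rpow_natCast, ← Real.rpow_mul hj.le, hα]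
    congr 2
    push_cast
    ring
  have e2 : ((j : ℝ) + 1) ^ (1 - α - 1) = y⁻¹ := by
    rw [hy, ← Real.rpow_neg hj.le]; congr 1; ring
  have a1 : α * y⁻¹ ≤ K⁻¹ := by
    rw [← div_eq_mul_inv, div_le_iff₀ hypos, inv_mul_eq_div, le_div_iff₀ hKpos]
    exact hu
  have a2 : K⁻¹ ≤ α * y⁻¹ + (y ^ 2)⁻¹ := by
    have : α * y⁻¹ + (y ^ 2)⁻¹ = (α * y + 1) / y ^ 2 := by field_simp
    rw [this, inv_eq_one_div, div_le_div_iff₀ hKpos (by positivity)]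
    nlinarith
  have b1 : α * y⁻¹ ≤ β * (((j : ℝ) + 1) ^ (1 - α) - (j : ℝ) ^ (1 - α)) := by
    have := le_rpow_add_one_sub_rpow (p := 1 - α) (by linarith) (by linarith) (Nat.cast_nonneg j)
    rw [e2] at this
    calc α * y⁻¹ = β * ((1 - α) * y⁻¹) := by rw [← mul_assoc, hβ]
      _ ≤ _ := mul_le_mul_of_nonneg_left this hβ0.le
  have b2 : β * (((j : ℝ) + 1) ^ (1 - α) - (j : ℝ) ^ (1 - α))
      ≤ α * y⁻¹ + (β + 2) * (y ^ 2)⁻¹ := by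
    rcases Nat.eq_zero_or_pos j with rfl | hjp
    · have hy' : y = 1 := by simp [hy]
      rw [hy']
      have : (1 : ℝ) - α ≠ 0 := by linarith
      simp [Real.zero_rpow this]
      linarith
    · have hjp' : (1 : ℝ) ≤ j := by exact_mod_cast hjp
      have hj0 : (0 : ℝ) < j := by linarith
      set z := (j : ℝ) ^ α with hz
      have hz1 : 1 ≤ z := Real.one_le_rpow hjp' h0.le
      have hyz : y ≤ z + 1 := by
        have h3 := rpow_add_one_sub_rpow_le h0.le h1.le hj0
        have h4 : (j : ℝ) ^ (α - 1) ≤ 1 := Real.rpow_le_one_of_one_le_of_nonpos hjp' (by linarith)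
        nlinarith [Real.rpow_nonneg hj0.le (α - 1)]
      have h5 := rpow_add_one_sub_rpow_le (p := 1 - α) (by linarith) (by linarith) hj0
      have e3 : (j : ℝ) ^ (1 - α - 1) = z⁻¹ := by
        rw [hz, ← Real.rpow_neg hj0.le]; congr 1; ring
      rw [e3] at h5
      have h6 : z⁻¹ ≤ y⁻¹ + 2 * (y ^ 2)⁻¹ := by
        have : y⁻¹ + 2 * (y ^ 2)⁻¹ = (y + 2) / y ^ 2 := by field_simp
        rw [this, inv_eq_one_div, div_le_div_iff₀ (by linarith) (by positivity)]
        nlinarith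
      have h7 : 0 < (y ^ 2)⁻¹ := by positivity
      calc _ ≤ β * ((1 - α) * z⁻¹) := mul_le_mul_of_nonneg_left h5 hβ0.le
        _ = α * z⁻¹ := by rw [← mul_assoc, hβ]
        _ ≤ α * (y⁻¹ + 2 * (y ^ 2)⁻¹) := mul_le_mul_of_nonneg_left h6 h0.le
        _ ≤ _ := by nlinarith [mul_pos hβ0 h7]
  rw [e1]
  have h7 : 0 < (y ^ 2)⁻¹ := by positivity
  rw [abs_le]
  constructor <;> nlinarith [mul_pos hβ0 h7]

lemma inv_lorentzWeight_sq_le {q : ℝ} (hq : 1 < q) (j : ℕ) :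
    (lorentzWeight q (j + 1))⁻¹ ^ 2 ≤ ((j : ℝ) + 1) ^ (-(2 / q)) := by
  have hr := rpow_le_lorentzWeight hq (Nat.succ_pos j)
  push_cast at hr
  have hj : (0 : ℝ) < j + 1 := by positivity
  have hypos : 0 < ((j : ℝ) + 1) ^ (1 / q) := Real.rpow_pos_of_pos hj _
  have e1 : ((j : ℝ) + 1) ^ (-(2 / q)) = (((j : ℝ) + 1) ^ (1 / q))⁻¹ ^ 2 := by
    rw [Real.rpow_neg hj.le, inv_pow, ← Real.rpow_natCast, ← Real.rpow_mul hj.le]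
    congr 2
    push_cast
    ring
  rw [e1]
  gcongr
  exact (inv_pos.2 (lorentzWeight_pos q (Nat.succ_pos j))).le

lemma sum_rpow_neg_le {p : ℝ} (h0 : 0 < p) (h1 : p < 1) (n : ℕ) :
    ∑ j ∈ Finset.range n, ((j : ℝ) + 1) ^ (-p) ≤ 1 / (1 - p) * (n : ℝ) ^ (1 - p) := by
  have hp : 0 < 1 - p := by linarith
  induction n with
  | zero => simp [Real.zero_rpow hp.ne']
  | succ n ih =>
    have h := le_rpow_add_one_sub_rpow (p := 1 - p) hp.le (by linarith) (Nat.cast_nonneg n)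
    rw [show 1 - p - 1 = -p by ring] at h
    have h2 := mul_le_mul_of_nonneg_left h (by positivity : 0 ≤ 1 / (1 - p))
    rw [← mul_assoc, one_div_mul_cancel hp.ne', one_mul] at h2
    rw [Finset.sum_range_succ]
    push_cast
    linarith

lemma one_le_log_of_three_le {n : ℕ} (hn : 3 ≤ n) : 1 ≤ Real.log n := by
  rw [Real.le_log_iff_exp_le (by positivity)]
  have := Real.exp_one_lt_d9
  have : (3 : ℝ) ≤ n := by exact_mod_cast hn
  linarith

lemma exists_rpow_mul_sum_le_deltan {q : ℝ} (hq : 1 < q) :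
    ∃ C : ℝ, 0 < C ∧ ∀ n : ℕ, 3 ≤ n →
      (n : ℝ) ^ (1 / q - 1) * ∑ j ∈ Finset.range n, ((j : ℝ) + 1) ^ (-(2 / q))
        ≤ C * deltan q n := by
  rcases lt_trichotomy q 2 with h | h | h
  · have hs : Summable fun j : ℕ => ((j : ℝ) + 1) ^ (-(2 / q)) := by
      have h1 : 1 < 2 / q := by rw [lt_div_iff₀ (by linarith)]; linarith
      have := (summable_nat_add_iff 1).2 (Real.summable_nat_rpow.2 (by linarith : -(2 / q) < -1))
      simpa using this
    refine ⟨∑' j : ℕ, ((j : ℝ) + 1) ^ (-(2 / q)), ?_, fun n hn => ?_⟩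
    · exact hs.tsum_pos (fun j => by positivity) 0 (by positivity)
    · rw [deltan, if_pos h, mul_comm]
      gcongr
      exact hs.sum_le_tsum _ fun j _ => by positivity
  · subst h
    refine ⟨2, by norm_num, fun n hn => ?_⟩
    have h1 := harmonic_le_one_add_log n
    have h2 : ((harmonic n : ℚ) : ℝ) = ∑ j ∈ Finset.range n, ((j : ℝ) + 1) ^ (-((2 : ℝ) / 2)) := by
      rw [harmonic]
      push_cast
      refine Finset.sum_congr rfl fun j _ => ?_
      rw [div_self two_ne_zero, Real.rpow_neg_one]
    have h3 := one_le_log_of_three_le hn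
    rw [deltan, if_neg (lt_irrefl _), if_pos rfl, ← h2,
      show (1 : ℝ) / 2 - 1 = -1 / 2 by norm_num]
    have h4 : 0 ≤ (n : ℝ) ^ (-(1 : ℝ) / 2) := by positivity
    nlinarith
  · have h0 : 0 < 2 / q := by positivity
    have h1 : 2 / q < 1 := by rw [div_lt_one (by linarith)]; exact h
    refine ⟨1 / (1 - 2 / q), by have : 0 < 1 - 2 / q := by linarith
                                positivity, fun n hn => ?_⟩
    have hn0 : (0 : ℝ) < n := by positivity
    rw [deltan, if_neg (by linarith), if_neg (by linarith)]
    calc _ ≤ (n : ℝ) ^ (1 / q - 1) * (1 / (1 - 2 / q) * (n : ℝ) ^ (1 - 2 / q)) := by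
          gcongr
          exact sum_rpow_neg_le h0 h1 n
      _ = 1 / (1 - 2 / q) * ((n : ℝ) ^ (1 / q - 1) * (n : ℝ) ^ (1 - 2 / q)) := by ring
      _ = _ := by
          rw [← Real.rpow_add hn0]
          congr 2
          ring

lemma rpow_le_deltan {q : ℝ} (hq : 1 < q) {n : ℕ} (hn : 3 ≤ n) :
    (n : ℝ) ^ (1 / q - 1) ≤ deltan q n ∧ (n : ℝ) ^ (-(1 : ℝ) / 2) ≤ deltan q n := by
  have h1n : (1 : ℝ) ≤ n := by exact_mod_cast (by omega : 1 ≤ n)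
  rcases lt_trichotomy q 2 with h | h | h
  · rw [deltan, if_pos h]
    refine ⟨le_rfl, Real.rpow_le_rpow_of_exponent_le h1n ?_⟩
    have : 1 / 2 < 1 / q := one_div_lt_one_div_of_lt (by linarith) h
    linarith
  · subst h
    rw [deltan, if_neg (lt_irrefl _), if_pos rfl, show (1 : ℝ) / 2 - 1 = -1 / 2 by norm_num]
    have := le_mul_of_one_le_right (by positivity : 0 ≤ (n : ℝ) ^ (-(1 : ℝ) / 2))
      (one_le_log_of_three_le hn)
    exact ⟨this, this⟩
  · rw [deltan, if_neg (by linarith), if_neg (by linarith)]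
    have : 1 / q < 1 / 2 := one_div_lt_one_div_of_lt (by linarith) h
    constructor <;> refine Real.rpow_le_rpow_of_exponent_le h1n ?_ <;> linarith

lemma sum_fin_filter_le_eq_sum_Ico {n : ℕ} (i : ℕ) (f : ℕ → ℝ) :
    ∑ j with i ≤ (j : Fin n).val, f j = ∑ j ∈ Finset.Ico i n, f j := by
  rw [Finset.sum_filter, Fin.sum_univ_eq_sum_range (fun j => if i ≤ j then f j else 0) n,
    ← Finset.sum_filter]
  congr 1
  ext j
  simp only [Finset.mem_filter, Finset.mem_range, Finset.mem_Ico]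
  omega

lemma Gq_div_eq {q : ℝ} {n : ℕ} (hn : 0 < n) (i : ℕ) :
    Gq q ((i : ℝ) / n) = (n : ℝ) ^ (1 / q - 1) *
      (1 / (q - 1) * ((n : ℝ) ^ (1 - 1 / q) - (i : ℝ) ^ (1 - 1 / q))) := by
  have hn0 : (0 : ℝ) < n := by exact_mod_cast hn
  have h1 : (n : ℝ) ^ (1 / q - 1) = ((n : ℝ) ^ (1 - 1 / q))⁻¹ := by
    rw [← Real.rpow_neg hn0.le]; congr 1; ring
  have h2 : 0 < (n : ℝ) ^ (1 - 1 / q) := Real.rpow_pos_of_pos hn0 _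
  rw [Gq, Real.div_rpow (Nat.cast_nonneg i) hn0.le, h1]
  field_simp

lemma exists_deltan_bounds {q : ℝ} (hq : 1 < q) :
    ∃ C : ℝ, 0 < C ∧ ∀ n : ℕ, 3 ≤ n →
      (∀ i : Fin n, |(n : ℝ) ^ (1 / q - 1) *
          ∑ j with i.val ≤ (j : Fin n).val, (lorentzWeight q (j + 1))⁻¹ - Gq q ((i : ℝ) / n)|
        ≤ C * deltan q n) ∧
      ∑ j : Fin n, ((n : ℝ) ^ (1 / q - 1) * (lorentzWeight q (j + 1))⁻¹) ^ 2
        ≤ C * deltan q n ^ 2 := by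
  obtain ⟨C, hC, h⟩ := exists_rpow_mul_sum_le_deltan hq
  have hβ0 : 0 < 1 / (q - 1) := by have : 0 < q - 1 := by linarith
                                   positivity
  refine ⟨(1 / (q - 1) + 3) * C, by positivity, fun n hn => ⟨fun i => ?_, ?_⟩⟩
  · have hn0 : (0 : ℝ) < n := by positivity
    have htel : (n : ℝ) ^ (1 - 1 / q) - (i : ℝ) ^ (1 - 1 / q) = ∑ j ∈ Finset.Ico (i : ℕ) n,
        (((j : ℝ) + 1) ^ (1 - 1 / q) - (j : ℝ) ^ (1 - 1 / q)) := by
      rw [← Finset.sum_Ico_sub (fun j : ℕ => (j : ℝ) ^ (1 - 1 / q)) i.2.le]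
      push_cast
      rfl
    rw [sum_fin_filter_le_eq_sum_Ico (i : ℕ) fun j => (lorentzWeight q (j + 1))⁻¹,
      Gq_div_eq (by omega), ← mul_sub, htel, Finset.mul_sum, ← Finset.sum_sub_distrib, abs_mul,
      abs_of_nonneg (by positivity)]
    calc _ ≤ (n : ℝ) ^ (1 / q - 1) * ∑ j ∈ Finset.Ico (i : ℕ) n,
          (1 / (q - 1) + 3) * ((j : ℝ) + 1) ^ (-(2 / q)) := by
          gcongr
          exact (Finset.abs_sum_le_sum_abs _ _).trans
            (Finset.sum_le_sum fun j _ => abs_inv_lorentzWeight_sub_le hq j)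
      _ ≤ (n : ℝ) ^ (1 / q - 1) * ∑ j ∈ Finset.range n,
          (1 / (q - 1) + 3) * ((j : ℝ) + 1) ^ (-(2 / q)) := by
          gcongr
          intro j hj
          exact Finset.mem_range.2 (Finset.mem_Ico.1 hj).2
      _ = (1 / (q - 1) + 3) * ((n : ℝ) ^ (1 / q - 1) *
          ∑ j ∈ Finset.range n, ((j : ℝ) + 1) ^ (-(2 / q))) := by
          rw [← Finset.mul_sum]; ring
      _ ≤ (1 / (q - 1) + 3) * (C * deltan q n) :=
          mul_le_mul_of_nonneg_left (h n hn) (by positivity)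
      _ = _ := by ring
  · have hδ := (rpow_le_deltan hq hn).1
    have hp : 0 ≤ (n : ℝ) ^ (1 / q - 1) := by positivity
    calc _ ≤ ∑ j : Fin n, (n : ℝ) ^ (1 / q - 1) * (n : ℝ) ^ (1 / q - 1) *
          ((j : ℝ) + 1) ^ (-(2 / q)) := by
          refine Finset.sum_le_sum fun j _ => ?_
          rw [mul_pow, sq ((n : ℝ) ^ (1 / q - 1))]
          gcongr
          exact inv_lorentzWeight_sq_le hq j
      _ = (n : ℝ) ^ (1 / q - 1) * ((n : ℝ) ^ (1 / q - 1) *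
          ∑ j ∈ Finset.range n, ((j : ℝ) + 1) ^ (-(2 / q))) := by
          rw [← Finset.mul_sum,
            Fin.sum_univ_eq_sum_range (fun j : ℕ => ((j : ℝ) + 1) ^ (-(2 / q))) n, mul_assoc]
      _ ≤ deltan q n * (C * deltan q n) := by
          have := h n hn
          gcongr
          exact hp.trans hδ
      _ = C * deltan q n ^ 2 := by ring
      _ ≤ _ := by
          gcongr
          nlinarith

lemma ae_pi_stdExp_nonneg (n : ℕ) :
    ∀ᵐ t ∂Measure.pi (fun _ : Fin n => stdExp), ∀ i, 0 ≤ t i := by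
  rw [pi_stdExp n measurableSet_Ici restrict_Ioi_eq_restrict_Ici.symm]
  refine (withDensity_absolutelyContinuous _ _).ae_le ?_
  filter_upwards [ae_restrict_mem (MeasurableSet.univ_pi fun _ => measurableSet_Ici)] with t ht i
  exact ht i (Set.mem_univ i)

lemma volume_scaledLorentzBall {q : ℝ} {n : ℕ} (h : unifOn (scaledLorentzBall q n) Set.univ = 1) :
    volume (scaledLorentzBall q n) ≠ 0 ∧ volume (scaledLorentzBall q n) ≠ ⊤ := by
  rw [unifOn, Measure.smul_apply, Measure.restrict_apply_univ, smul_eq_mul] at h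
  constructor <;> intro h' <;> simp [h'] at h

lemma Gq_nonneg {q x : ℝ} (hq : 1 < q) (h0 : 0 ≤ x) (h1 : x ≤ 1) : 0 ≤ Gq q x := by
  have h : 1 / q ≤ 1 := by rw [div_le_one (by linarith)]; exact hq.le
  exact div_nonneg (sub_nonneg.2 (Real.rpow_le_one h0 h1 (by linarith))) (by linarith)

lemma Gq_le {q x : ℝ} (hq : 1 < q) (h0 : 0 ≤ x) : Gq q x ≤ 1 / (q - 1) := by
  have : 0 < q - 1 := by linarith
  rw [Gq]
  gcongr
  linarith [Real.rpow_nonneg h0 (1 - 1 / q)]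

/-- Points of `ℝⁿ` with an order statistic that, after rescaling by `c`, is at distance at
least `b` from the profile `G_q`. -/
def deviationSet (q c b : ℝ) (n : ℕ) : Set (Fin n → ℝ) :=
  {x | ∃ i : Fin n, b ≤ |c * sortedAbs x i - Gq q ((i : ℝ) / n)|}

lemma measurableSet_deviationSet (q c b : ℝ) (n : ℕ) : MeasurableSet (deviationSet q c b n) := by
  rw [deviationSet, Set.ofPred_exists]
  refine MeasurableSet.iUnion fun i => ?_
  have := measurable_sortedAbs i
  exact measurableSet_le measurable_const (by fun_prop)

lemma signedPerm_mem_deviationSet {q c b : ℝ} {n : ℕ} (g : Equiv.Perm (Fin n) × (Fin n → Bool))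
    (x : Fin n → ℝ) : signedPerm g x ∈ deviationSet q c b n ↔ x ∈ deviationSet q c b n := by
  simp only [deviationSet, Set.mem_ofPred_eq, sortedAbs_comp_perm (abs_signedPerm g x)]

lemma pi_stdExp_deviationSet_le {q C b : ℝ} {n : ℕ} (hb : C * deltan q n < b)
    (h1 : ∀ i : Fin n, |(n : ℝ) ^ (1 / q - 1) *
        ∑ j with i.val ≤ (j : Fin n).val, (lorentzWeight q (j + 1))⁻¹ - Gq q ((i : ℝ) / n)|
          ≤ C * deltan q n)
    (h2 : ∑ j : Fin n, ((n : ℝ) ^ (1 / q - 1) * (lorentzWeight q (j + 1))⁻¹) ^ 2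
        ≤ C * deltan q n ^ 2) :
    ENNReal.ofReal ((b - C * deltan q n) ^ 2) * Measure.pi (fun _ : Fin n => stdExp)
        (ofSpacings q n ⁻¹' deviationSet q ((n : ℝ) ^ (1 / q - 1)) b n)
      ≤ ENNReal.ofReal (C * deltan q n ^ 2) := by
  set c : Fin n → ℝ := fun j => (n : ℝ) ^ (1 / q - 1) * (lorentzWeight q (j + 1))⁻¹ with hc
  calc _ ≤ ENNReal.ofReal ((b - C * deltan q n) ^ 2) * Measure.pi (fun _ : Fin n => stdExp)
        {t | ∃ k : ℕ, b - C * deltan q n ≤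
          |0 + ∑ j with k ≤ (j : Fin n).val, c j * (t j - 1)|} := by
        refine mul_le_mul_right (measure_mono_ae ?_) _
        filter_upwards [ae_pi_stdExp_nonneg n] with t ht ⟨i, hi⟩
        refine ⟨i, ?_⟩
        have hC := ofSpacings_mem_closedChamber (q := q) ht
        rw [sortedAbs_eq_self hC.1 hC.2, ofSpacings_apply] at hi
        have e : (n : ℝ) ^ (1 / q - 1) * ∑ j with i ≤ j, (lorentzWeight q ((j : Fin n) + 1))⁻¹ * t j
              - Gq q ((i : ℝ) / n)
            = (0 + ∑ j with i.val ≤ (j : Fin n).val, c j * (t j - 1)) + ((n : ℝ) ^ (1 / q - 1) *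
              ∑ j with i.val ≤ (j : Fin n).val, (lorentzWeight q (j + 1))⁻¹
                - Gq q ((i : ℝ) / n)) := by
          simp only [hc, Fin.le_def, mul_sub, Finset.sum_sub_distrib, Finset.mul_sum, mul_assoc]
          simp only [mul_one]
          ring
        rw [e] at hi
        linarith [abs_add_le (0 + ∑ j with i.val ≤ (j : Fin n).val, c j * (t j - 1))
          ((n : ℝ) ^ (1 / q - 1) * ∑ j with i.val ≤ (j : Fin n).val, (lorentzWeight q (j + 1))⁻¹
                - Gq q ((i : ℝ) / n)), h1 i]
    _ ≤ ENNReal.ofReal (0 ^ 2 + ∑ j, c j ^ 2) := pi_stdExp_maximal n c 0 _ (by linarith)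
    _ ≤ _ := ENNReal.ofReal_le_ofReal (by rwa [zero_pow two_ne_zero, zero_add])

lemma abs_div_sub_one_le {n : ℕ} (hn : 36 ≤ n) {s : ℝ} (hs : (s - (n + 1)) ^ 2 < 2 * (n + 1)) :
    |s / n - 1| ≤ 3 * (n : ℝ) ^ (-(1 : ℝ) / 2) ∧ 1 / 2 ≤ s / n := by
  have hn' : (36 : ℝ) ≤ n := by exact_mod_cast hn
  have hn0 : (0 : ℝ) < n := by linarith
  have e : (n : ℝ) ^ (-(1 : ℝ) / 2) = (√n)⁻¹ := by
    rw [Real.sqrt_eq_rpow, ← Real.rpow_neg hn0.le]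
    norm_num
  have hr6 : 6 ≤ √(n : ℝ) := Real.le_sqrt_of_sq_le (by linarith)
  have hsq := Real.sq_sqrt hn0.le
  set r := √(n : ℝ)
  have hb : |s - n| ≤ 3 * r := by
    have h1 : |s - (n + 1)| ≤ 2 * r := abs_le_of_sq_le_sq (by nlinarith) (by linarith)
    rw [abs_le] at h1 ⊢
    constructor <;> linarith
  have hb' : |s / n - 1| ≤ 3 * r⁻¹ := by
    rw [div_sub_one hn0.ne', abs_div, abs_of_pos hn0, div_le_iff₀ hn0]
    have : 3 * r⁻¹ * n = 3 * r := by
      rw [← hsq]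
      field_simp
    rwa [this]
  refine ⟨by rwa [e], ?_⟩
  have : r⁻¹ ≤ 6⁻¹ := inv_anti₀ (by norm_num) hr6
  linarith [(abs_le.1 hb').1]

lemma smul_mem_deviationSet {q b : ℝ} (hq : 1 < q) {n : ℕ} (hn : 36 ≤ n) {s : ℝ} (hs0 : 0 < s)
    (hs : (s - (n + 1)) ^ 2 < 2 * (n + 1)) {x : Fin n → ℝ} (hx : x ∈ deviationSet q 1 b n)
    (hb : 0 ≤ b) :
    (s / (n : ℝ) ^ (1 / q)) • x ∈ deviationSet q ((n : ℝ) ^ (1 / q - 1))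
      (b / 2 - 3 / (q - 1) * deltan q n) n := by
  obtain ⟨i, hi⟩ := hx
  refine ⟨i, ?_⟩
  have hn0 : (0 : ℝ) < n := by positivity
  have hr : 0 < (n : ℝ) ^ (1 / q) := by positivity
  obtain ⟨h1, h2⟩ := abs_div_sub_one_le hn hs
  have h3 := (rpow_le_deltan hq (by omega : 3 ≤ n)).2
  have hin : (i : ℝ) / n ≤ 1 := by
    rw [div_le_one hn0]
    exact_mod_cast i.2.le
  have g0 := Gq_nonneg hq (by positivity : 0 ≤ (i : ℝ) / n) hin
  have g1 := Gq_le hq (by positivity : 0 ≤ (i : ℝ) / n)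
  have hβ : 0 < q - 1 := by linarith
  rw [sortedAbs_smul (by positivity), Real.rpow_sub_one hn0.ne']
  rw [one_mul] at hi
  set G := Gq q ((i : ℝ) / n)
  set y := sortedAbs x i
  have e : (n : ℝ) ^ (1 / q) / n * (s / (n : ℝ) ^ (1 / q) * y) - G
      = s / n * (y - G) + (s / n - 1) * G := by
    field_simp
    ring
  have k1 : b / 2 ≤ |s / n * (y - G)| := by
    rw [abs_mul, abs_of_pos (by linarith)]
    nlinarith
  have k2 : |(s / n - 1) * G| ≤ 3 / (q - 1) * deltan q n := by
    rw [abs_mul, abs_of_nonneg g0]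
    calc _ ≤ 3 * deltan q n * (1 / (q - 1)) :=
          mul_le_mul (by linarith) g1 g0 (by linarith [abs_nonneg (s / n - 1)])
      _ = _ := by ring
  rw [e]
  have k3 := abs_sub_abs_le_abs_sub (s / n * (y - G)) (-((s / n - 1) * G))
  rw [abs_neg, sub_neg_eq_add] at k3
  linarith

lemma unifOn_deviationSet_le {q : ℝ} (hq : 1 < q) {n : ℕ} (hn : 36 ≤ n) {b : ℝ} (hb : 0 ≤ b)
    (h : unifOn (scaledLorentzBall q n) Set.univ = 1) :
    unifOn (scaledLorentzBall q n) (deviationSet q 1 b n) ≤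
      2 * Measure.pi (fun _ : Fin n => stdExp) (ofSpacings q n ⁻¹'
        deviationSet q ((n : ℝ) ^ (1 / q - 1)) (b / 2 - 3 / (q - 1) * deltan q n) n) := by
  obtain ⟨hv0, hvt⟩ := volume_scaledLorentzBall h
  have hr : 0 < (n : ℝ) ^ (1 / q) := Real.rpow_pos_of_pos (by positivity) _
  have hD : scaledLorentzBall q n = {x | lorentzNorm q x ≤ (n : ℝ) ^ (1 / q)} :=
    Set.ext fun x => mem_scaledLorentzBall (by omega)
  set A' := deviationSet q ((n : ℝ) ^ (1 / q - 1)) (b / 2 - 3 / (q - 1) * deltan q n) n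
  set ν := Measure.pi (fun _ : Fin n => stdExp) (ofSpacings q n ⁻¹' A')
  have hA' : MeasurableSet A' := measurableSet_deviationSet _ _ _ _
  have h1 := volume_inter_lorentz_le q hr hA' (A := deviationSet q 1 b n)
    fun s hs0 hs x hx => smul_mem_deviationSet hq hn hs0 hs hx hb
  have h2 := lorentzExp_le q hA' signedPerm_mem_deviationSet
  have h3 := lorentzExp_univ (n := n) q hr
  rw [← hD] at h1 h3
  have hf : (0 : ℝ) < n.factorial / 2 := by positivity
  have hf0 : ENNReal.ofReal (n.factorial / 2 : ℝ) ≠ 0 := by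
    rwa [Ne, ENNReal.ofReal_eq_zero, not_le]
  have hff : ENNReal.ofReal (n.factorial : ℝ) = ENNReal.ofReal (n.factorial / 2 : ℝ) * 2 := by
    rw [← ENNReal.ofReal_ofNat, ← ENNReal.ofReal_mul hf.le]
    congr 1
    ring
  have h4 : ENNReal.ofReal (n.factorial / 2 : ℝ) *
        volume (deviationSet q 1 b n ∩ scaledLorentzBall q n)
      ≤ ENNReal.ofReal (n.factorial / 2 : ℝ) * (volume (scaledLorentzBall q n) * (2 * ν)) :=
    calc _ ≤ _ := h1
      _ ≤ ENNReal.ofReal (((n : ℝ) ^ (1 / q)) ^ n) * (lorentzExp q n Set.univ * ν) := by gcongr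
      _ = ENNReal.ofReal (n.factorial / 2 : ℝ) * 2 * volume (scaledLorentzBall q n) * ν := by
          rw [← mul_assoc, h3, hff]
      _ = _ := by ring
  rw [ENNReal.mul_le_mul_iff_right hf0 ENNReal.ofReal_ne_top] at h4
  rw [unifOn, Measure.smul_apply, Measure.restrict_apply (measurableSet_deviationSet _ _ _ _),
    smul_eq_mul]
  calc _ ≤ (volume (scaledLorentzBall q n))⁻¹ * (volume (scaledLorentzBall q n) * (2 * ν)) := by
        gcongr
    _ = 2 * ν := by rw [← mul_assoc, ENNReal.inv_mul_cancel hv0 hvt, one_mul]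

lemma exists_unifOn_deviationSet_le {q : ℝ} (hq : 1 < q) :
    ∃ K M : ℝ, ∀ n : ℕ, 36 ≤ n → ∀ b : ℝ, M ≤ b → 0 < b →
      unifOn (scaledLorentzBall q n) Set.univ = 1 →
      unifOn (scaledLorentzBall q n) (deviationSet q 1 (b * deltan q n) n)
        ≤ ENNReal.ofReal (K / b ^ 2) := by
  obtain ⟨C, hC, h⟩ := exists_deltan_bounds hq
  refine ⟨2 * (16 * C), 4 * (C + 3 / (q - 1)), fun n hn b hMb hb0 huniv => ?_⟩
  obtain ⟨h1, h2⟩ := h n (by omega)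
  have hδ : 0 < deltan q n :=
    (Real.rpow_pos_of_pos (by positivity) _).trans_le (rpow_le_deltan hq (by omega : 3 ≤ n)).1
  have hu := unifOn_deviationSet_le hq hn (mul_nonneg hb0.le hδ.le) huniv
  set b' := b * deltan q n / 2 - 3 / (q - 1) * deltan q n with hb'
  have hgap : b / 4 * deltan q n ≤ b' - C * deltan q n := by
    rw [hb']
    nlinarith
  have hpos : 0 < b / 4 * deltan q n := by positivity
  have hν := pi_stdExp_deviationSet_le (b := b') (by linarith) h1 h2
  refine hu.trans ?_
  set ν := Measure.pi (fun _ : Fin n => stdExp) (ofSpacings q n ⁻¹'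
        deviationSet q ((n : ℝ) ^ (1 / q - 1)) b' n)
  have hν' : ν ≤ ENNReal.ofReal (16 * C / b ^ 2) := by
    have h5 : ENNReal.ofReal ((b / 4 * deltan q n) ^ 2) * ν
        ≤ ENNReal.ofReal ((b / 4 * deltan q n) ^ 2) * ENNReal.ofReal (16 * C / b ^ 2) :=
      calc _ ≤ ENNReal.ofReal ((b' - C * deltan q n) ^ 2) * ν := by gcongr
        _ ≤ _ := hν
        _ = _ := by
            rw [← ENNReal.ofReal_mul (by positivity)]
            congr 1
            field_simp
            ring
    refine (ENNReal.mul_le_mul_iff_right ?_ ENNReal.ofReal_ne_top).1 h5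
    rw [Ne, ENNReal.ofReal_eq_zero, not_le]
    positivity
  calc 2 * ν ≤ 2 * ENNReal.ofReal (16 * C / b ^ 2) := by gcongr
    _ = _ := by
        rw [← ENNReal.ofReal_ofNat, ← ENNReal.ofReal_mul (by norm_num)]
        congr 1
        ring

/-- Uniform approximation of the order statistics of a uniform random point of
`D̃_{q,1}^n` by the profile `G_q`: for any positive sequence `a_n → ∞`,
`P[max_{1 ≤ i ≤ n} |(X̃_i^{(n)})^* - G_q((i-1)/n)| ≥ a_n δ_n] → 0`. -/
theorem uniform_order_statistics_approx (q : ℝ) (hq : 1 < q)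
    {Ω : Type*} [MeasurableSpace Ω] (P : Measure Ω) [IsProbabilityMeasure P]
    (X : (n : ℕ) → Ω → Fin n → ℝ) (hXmeas : ∀ n, Measurable (X n))
    (hX : ∀ n, Measure.map (X n) P = unifOn (scaledLorentzBall q n))
    (a : ℕ → ℝ) (hapos : ∀ n, 0 < a n) (ha : Tendsto a atTop atTop) :
    Tendsto (fun n : ℕ =>
        P {ω | ∃ i : Fin n,
            a n * deltan q n ≤ |sortedAbs (X n ω) i - Gq q ((i : ℝ) / n)|})
      atTop (nhds 0) := by
  obtain ⟨K, M, h⟩ := exists_unifOn_deviationSet_le hq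
  have hlim : Tendsto (fun n => ENNReal.ofReal (K / a n ^ 2)) atTop (nhds 0) := by
    rw [← ENNReal.ofReal_zero]
    refine (ENNReal.continuous_ofReal.tendsto 0).comp ?_
    exact tendsto_const_nhds.div_atTop ((tendsto_pow_atTop two_ne_zero).comp ha)
  refine tendsto_of_tendsto_of_tendsto_of_le_of_le' tendsto_const_nhds hlim
    (Eventually.of_forall fun _ => zero_le) ?_
  filter_upwards [ha.eventually_ge_atTop M, eventually_ge_atTop 36] with n hMn hn
  have huniv : unifOn (scaledLorentzBall q n) Set.univ = 1 := by
    rw [← hX n, Measure.map_apply (hXmeas n) MeasurableSet.univ, Set.preimage_univ, measure_univ]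
  refine le_trans (le_of_eq ?_) (h n hn (a n) hMn (hapos n) huniv)
  rw [← hX n, Measure.map_apply (hXmeas n) (measurableSet_deviationSet _ _ _ _)]
  simp only [deviationSet, one_mul, Set.preimage_ofPred_eq]

end
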